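/- Let S be a 2-dimensional complete regular local ring, f = f_1 ⋯ f_n a product of pairwise non-associate prime elements, R = S/(f). For subsets I, J of {1,…,n}, Ext_R^1(S_I, S_J) = 0 if and only if I ⊆ J or J ⊆ I. -/

import Mathlib

open CategoryTheory Opposite IsLocalRing

noncomputable abbrev ExtGroup (R : Type) [CommRing R] (i : ℕ)
    (M N : Type) [AddCommGroup M] [Module R M] [AddCommGroup N] [Module R N] : Type :=
  ((Ext R (ModuleCat R) i).obj (op (ModuleCat.of R M))).obj (ModuleCat.of R N)

def IsRegularLocalTwoDim (S : Type) [CommRing S] [IsLocalRing S] : Prop :=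
  IsNoetherianRing S ∧ ringKrullDim S = 2 ∧
    ∃ x y : S, IsLocalRing.maximalIdeal S = Ideal.span {x, y}

noncomputable abbrev mulHom {R : Type} [CommRing R] (a : R) : ModuleCat.of R R ⟶ ModuleCat.of R R :=
  ModuleCat.ofHom (LinearMap.mulLeft R a)

lemma mulHom_comp {R : Type} [CommRing R] (a b : R) (h : a * b = 0) : mulHom b ≫ mulHom a = 0 := by
  ext
  simp [h]

noncomputable abbrev perCx {R : Type} [CommRing R] (a b : R) (h : a * b = 0) :
    ChainComplex (ModuleCat R) ℕ :=
  HomologicalComplex.alternatingConst (ModuleCat.of R R) (φ := mulHom b) (ψ := mulHom a)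
    (mulHom_comp a b h) (mulHom_comp b a (by rw [mul_comm, h]))
    fun _ _ => ComplexShape.down_nat_odd_add

lemma perCx_d_odd {R : Type} [CommRing R] (a b : R) (h : a * b = 0) (i : ℕ) (hi : Even i) :
    (perCx a b h).d (i+1) i = mulHom a := by
  change (if (ComplexShape.down ℕ).Rel (i + 1) i then if Even (i + 1) then mulHom b else mulHom a
    else 0) = mulHom a
  rw [if_pos (by simp), if_neg (by simpa using hi.add_one)]

lemma perCx_d_even {R : Type} [CommRing R] (a b : R) (h : a * b = 0) (i : ℕ) (hi : Odd i) :
    (perCx a b h).d (i+1) i = mulHom b := by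
  change (if (ComplexShape.down ℕ).Rel (i + 1) i then if Even (i + 1) then mulHom b else mulHom a
    else 0) = mulHom b
  rw [if_pos (by simp), if_pos (by simpa using hi.add_one)]

noncomputable def perπ {R : Type} [CommRing R] (a b : R) (h : a * b = 0) :
    perCx a b h ⟶ (ChainComplex.single₀ (ModuleCat R)).obj (ModuleCat.of R (R ⧸ Ideal.span {a})) :=
  ((perCx a b h).toSingle₀Equiv _).symm
    ⟨(ModuleCat.ofHom (Submodule.mkQ (Ideal.span {a})) : ModuleCat.of R R ⟶ _), by
      rw [perCx_d_odd a b h 0 (by simp)]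
      ext
      change Submodule.Quotient.mk (a * 1) = _
      exact (Submodule.Quotient.mk_eq_zero _).2 (by simp)⟩

lemma perπ_quasiIso {R : Type} [CommRing R] (a b : R) (h : a * b = 0)
    (hb : ∀ x, b * x = 0 → a ∣ x) (ha : ∀ x, a * x = 0 → b ∣ x) : QuasiIso (perπ a b h) where
  quasiIsoAt m := by
    induction m with
    | zero =>
      simp only [perπ]
      rw [ChainComplex.quasiIsoAt₀_iff, ShortComplex.quasiIso_iff_of_zeros' _ rfl rfl rfl]
      constructor
      · rw [ShortComplex.moduleCat_exact_iff]
        intro x hx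
        change R at x
        have hx' : (Submodule.Quotient.mk x : R ⧸ Ideal.span {a}) = 0 := by
          simpa [ChainComplex.toSingle₀Equiv] using! hx
        rw [Submodule.Quotient.mk_eq_zero, Ideal.mem_span_singleton] at hx'
        obtain ⟨y, rfl⟩ := hx'
        refine ⟨(y : R), ?_⟩
        change ((perCx a b h).d 1 0) y = _
        rw [perCx_d_odd a b h 0 (by simp)]
        rfl
      · rw [ModuleCat.epi_iff_surjective]
        intro x
        obtain ⟨y, hy⟩ := Submodule.Quotient.mk_surjective _ (x : R ⧸ Ideal.span {a})
        use (y : R)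
        simpa [ChainComplex.toSingle₀Equiv] using! hy
    | succ m _ =>
      rw [quasiIsoAt_iff_exactAt' (hL := ChainComplex.exactAt_succ_single_obj ..),
          HomologicalComplex.exactAt_iff' _ (m + 2) (m + 1) m (by simp) (by simp)]
      rw [ShortComplex.moduleCat_exact_iff]
      intro x hx
      change R at x
      change ((perCx a b h).d (m+1) m) x = 0 at hx
      change ∃ y : R, ((perCx a b h).d (m+2) (m+1)) y = x
      by_cases hm : Odd m
      · rw [perCx_d_even a b h m hm] at hx
        rw [perCx_d_odd a b h (m+1) (by simpa using hm.add_one)]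
        obtain ⟨y, rfl⟩ := hb x hx
        exact ⟨y, rfl⟩
      · rw [Nat.not_odd_iff_even] at hm
        rw [perCx_d_odd a b h m hm] at hx
        rw [perCx_d_even a b h (m+1) (by simpa using hm.add_one)]
        obtain ⟨y, rfl⟩ := ha x hx
        exact ⟨y, rfl⟩

noncomputable def perRes {R : Type} [CommRing R] (a b : R) (h : a * b = 0)
    (hb : ∀ x, b * x = 0 → a ∣ x) (ha : ∀ x, a * x = 0 → b ∣ x) :
    ProjectiveResolution (ModuleCat.of R (R ⧸ Ideal.span {a})) where
  complex := perCx a b h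
  projective _ := inferInstanceAs <| Projective (ModuleCat.of R R)
  π := perπ a b h
  quasiIso := perπ_quasiIso a b h hb ha

lemma ext_one_iff {R : Type} [CommRing R] (a b : R) (h : a * b = 0)
    (hb : ∀ x, b * x = 0 → a ∣ x) (ha : ∀ x, a * x = 0 → b ∣ x)
    (N : Type) [AddCommGroup N] [Module R N] :
    Subsingleton (ExtGroup R 1 (R ⧸ Ideal.span {a}) N) ↔ ∀ x : N, b • x = 0 → ∃ y, a • y = x := by
  have e := (perRes a b h hb ha).isoExt (R := R) 1 (ModuleCat.of R N)
  rw [ExtGroup, ← ModuleCat.isZero_iff_subsingleton, e.isZero_iff,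
    ← HomologicalComplex.exactAt_iff_isZero_homology,
    HomologicalComplex.exactAt_iff' _ 0 1 2 (by simp) (by simp),
    ShortComplex.moduleCat_exact_iff]
  change (∀ x : ModuleCat.of R R ⟶ ModuleCat.of R N, (perCx a b h).d 2 1 ≫ x = 0 →
    ∃ y : ModuleCat.of R R ⟶ ModuleCat.of R N, (perCx a b h).d 1 0 ≫ y = x) ↔ _
  rw [perCx_d_odd a b h 0 (by simp), perCx_d_even a b h 1 (by simp)]
  constructor
  · intro H x hx
    obtain ⟨y, hy⟩ := H (ModuleCat.ofHom (LinearMap.toSpanSingleton R N x)) (by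
      ext
      change (b * 1) • x = 0
      rw [mul_one, hx])
    refine ⟨y.hom (1:R), ?_⟩
    have h1 := congrArg (fun t => t.hom (1:R)) hy
    change y.hom (a * 1) = (1 : R) • x at h1
    rw [one_smul] at h1
    exact (y.hom.map_smul a (1:R)).symm.trans h1
  · intro H x hx
    obtain ⟨y, hy⟩ := H (x.hom (1:R)) (by
      have h1 := congrArg (fun t => t.hom (1:R)) hx
      exact (x.hom.map_smul b (1:R)).symm.trans h1)
    refine ⟨ModuleCat.ofHom (LinearMap.toSpanSingleton R N y), ?_⟩
    ext
    change (a * 1) • y = x.hom (1:R)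
    rw [mul_one, hy]

lemma isDomain_of_regular (S : Type) [CommRing S] [IsLocalRing S] (hS : IsRegularLocalTwoDim S) :
    IsDomain S := by
  obtain ⟨hN, hd, x, y, hm⟩ := hS
  have hx : x ∈ maximalIdeal S := hm ▸ Ideal.subset_span (by simp)
  -- a chain of primes
  have hht : (maximalIdeal S).height = 2 := by
    have := IsLocalRing.maximalIdeal_height_eq_ringKrullDim (R := S)
    rw [hd] at this
    exact WithBot.coe_injective this
  obtain ⟨q, p, hq, hp, hqp, hpm⟩ : ∃ q p : Ideal S, q.IsPrime ∧ p.IsPrime ∧ q < p ∧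
      p < maximalIdeal S := by
    by_contra! hcon
    have h1 : (maximalIdeal S).height ≤ (1 : ℕ) := by
      rw [Ideal.height_le_iff]
      intro p hp hpm
      have : p.height ≤ (0 : ℕ) := by
        rw [Ideal.height_le_iff]
        intro q hq hqp
        exact absurd hpm (hcon q p hq hp hqp)
      refine lt_of_le_of_lt this ?_
      norm_num
    rw [hht] at h1
    norm_num at h1
  -- primes containing x
  have key : ∀ P : Ideal S, P.IsPrime → x ∈ P → P ≠ maximalIdeal S → P = Ideal.span {x} := by
    intro P hP hxP hPm
    have hyP : y ∉ P := by
      intro hyP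
      apply hPm
      refine le_antisymm (IsLocalRing.le_maximalIdeal hP.ne_top) ?_
      rw [hm, Ideal.span_le]
      rintro z (rfl | rfl) <;> assumption
    refine le_antisymm ?_ (by simpa [Ideal.span_le] using hxP)
    refine Submodule.le_of_le_smul_of_le_jacobson_bot (I := maximalIdeal S)
      (IsNoetherian.noetherian P) (IsLocalRing.maximalIdeal_le_jacobson _) ?_
    intro z hz
    have hz' : z ∈ Ideal.span {x, y} := hm ▸ IsLocalRing.le_maximalIdeal hP.ne_top hz
    obtain ⟨a, b, rfl⟩ := Ideal.mem_span_pair.1 hz'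
    have hby : b * y ∈ P := (P.add_mem_iff_right (P.mul_mem_left a hxP)).1 hz
    have hb : b ∈ P := (hP.mem_or_mem hby).resolve_right hyP
    refine Submodule.add_mem_sup (Ideal.mem_span_singleton.2 ⟨a, mul_comm _ _⟩) ?_
    rw [mul_comm]
    exact Ideal.mul_mem_mul (hm ▸ Ideal.subset_span (by simp)) hb
  have hnm : maximalIdeal S ∉ (Ideal.span (insert x (q : Set S))).minimalPrimes := by
    intro hmin
    have := Ideal.mem_minimalPrimes_span_of_mem_minimalPrimes_span_insert hpm x (q : Set S) hmin
      (q : Set S) hqp.le (fun z hz => Ideal.le_radical (Ideal.subset_span (Or.inr hz)))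
    rw [Ideal.span_eq] at this
    exact absurd (this.2 ⟨hq, le_rfl⟩ hqp.le) hqp.not_ge
  obtain ⟨P, hPmin, hPle⟩ := Ideal.exists_minimalPrimes_le
    (I := Ideal.span (insert x (q : Set S))) (J := maximalIdeal S) (by
      rw [Ideal.span_le]
      rintro z (rfl | hz)
      · exact hx
      · exact (hqp.trans hpm).le hz)
  have hPp : P.IsPrime := hPmin.1.1
  have hPne : P ≠ maximalIdeal S := by rintro rfl; exact hnm hPmin
  have hPx : P = Ideal.span {x} := key P hPp (hPmin.1.2 (Ideal.subset_span (Or.inl rfl))) hPne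
  have hqP : q ≤ Ideal.span {x} := by
    rw [← hPx]
    exact fun z hz => hPmin.1.2 (Ideal.subset_span (Or.inr hz))
  have hxq : x ∉ q := by
    intro hxq
    have h1 := key p hp (hqp.le hxq) hpm.ne
    have h2 := key q hq hxq (hqp.trans hpm).ne
    exact hqp.ne (h2.trans h1.symm)
  have hq0 : q = ⊥ := by
    rw [eq_bot_iff]
    refine Submodule.le_of_le_smul_of_le_jacobson_bot (I := maximalIdeal S)
      (IsNoetherian.noetherian q) (IsLocalRing.maximalIdeal_le_jacobson _) ?_
    intro z hz
    obtain ⟨w, rfl⟩ := Ideal.mem_span_singleton.1 (hqP hz)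
    have hw : w ∈ q := (hq.mem_or_mem hz).resolve_left hxq
    exact Submodule.mem_sup_right (Ideal.mul_mem_mul hx hw)
  subst hq0
  exact IsDomain.of_bot_isPrime S

lemma prod_dvd_of_disjoint {S : Type} [CommRing S] [IsDomain S] {n : ℕ} (f : Fin n → S)
    (hprime : ∀ i, Prime (f i)) (hassoc : ∀ i j, i ≠ j → ¬Associated (f i) (f j))
    (B : Finset (Fin n)) (A : Finset (Fin n)) : Disjoint A B → ∀ x : S,
    (∏ i ∈ A, f i) ∣ (∏ i ∈ B, f i) * x → (∏ i ∈ A, f i) ∣ x := by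
  induction A using Finset.induction_on with
  | empty => simp
  | insert a A ha ih =>
    intro hd x hx
    rw [Finset.disjoint_insert_left] at hd
    rw [Finset.prod_insert ha] at hx ⊢
    have h1 : f a ∣ x := by
      refine ((hprime a).dvd_or_dvd ((Dvd.intro _ rfl).trans hx)).resolve_left ?_
      intro h
      obtain ⟨j, hj, hj'⟩ := ((hprime a).dvd_finsetProd_iff _).1 h
      refine hassoc a j ?_ ((hprime a).associated_of_dvd (hprime j) hj')
      rintro rfl
      exact hd.1 hj
    obtain ⟨w, rfl⟩ := h1
    rw [mul_left_comm] at hx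
    exact mul_dvd_mul_left _ (ih hd.2 w ((mul_dvd_mul_iff_left (hprime a).ne_zero).1 hx))

/-- Let `S` be a `2`-dimensional complete regular local ring, `f = f_1 ⋯ f_n` a product of
pairwise non-associate primes, `R = S/(f)`, and for `I ⊆ {1,…,n}` set `S_I = S/(f_I)`
(realized as `R/(f_I)`).  Then `Ext_R^1(S_I, S_J) = 0` if and only if `I ⊆ J` or
`J ⊆ I`. -/
theorem ext_one_SI_SJ_vanishes_iff_subset
    (S : Type) [CommRing S] [IsLocalRing S] (hS : IsRegularLocalTwoDim S)
    (hcomp : IsAdicComplete (IsLocalRing.maximalIdeal S) S)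
    (n : ℕ) (f : Fin n → S) (hprime : ∀ i, Prime (f i))
    (hassoc : ∀ i j, i ≠ j → ¬Associated (f i) (f j))
    [IsLocalRing (S ⧸ Ideal.span {∏ i, f i})]
    (I J : Finset (Fin n)) :
    Subsingleton (ExtGroup (S ⧸ Ideal.span {∏ i, f i}) 1
      ((S ⧸ Ideal.span {∏ i, f i}) ⧸
        Ideal.span {Ideal.Quotient.mk (Ideal.span {∏ i, f i}) (∏ i ∈ I, f i)})
      ((S ⧸ Ideal.span {∏ i, f i}) ⧸
        Ideal.span {Ideal.Quotient.mk (Ideal.span {∏ i, f i}) (∏ i ∈ J, f i)})) ↔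
      I ⊆ J ∨ J ⊆ I := by
  have hdom := isDomain_of_regular S hS
  have hne : ∀ A : Finset (Fin n), ∏ i ∈ A, f i ≠ 0 := fun A =>
    Finset.prod_ne_zero_iff.2 fun i _ => (hprime i).ne_zero
  have hfull : (∏ i ∈ I, f i) * (∏ i ∈ Iᶜ, f i) = ∏ i, f i := Finset.prod_mul_prod_compl I f
  have hJf : (∏ i ∈ J, f i) ∣ ∏ i, f i := Finset.prod_dvd_prod_of_subset _ _ _ (Finset.subset_univ J)
  have hzero : ∀ s : S, (Ideal.Quotient.mk (Ideal.span {∏ i, f i}) s = 0 ↔ ∏ i, f i ∣ s) :=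
    fun s => by rw [Ideal.Quotient.eq_zero_iff_mem, Ideal.mem_span_singleton]
  have hzero2 : ∀ s : S, (Ideal.Quotient.mk (Ideal.span {Ideal.Quotient.mk
      (Ideal.span {∏ i, f i}) (∏ i ∈ J, f i)}) (Ideal.Quotient.mk (Ideal.span {∏ i, f i}) s) = 0 ↔
      ∏ i ∈ J, f i ∣ s) := by
    intro s
    rw [Ideal.Quotient.eq_zero_iff_mem, Ideal.mem_span_singleton]
    constructor
    · rintro ⟨t, ht⟩
      obtain ⟨t, rfl⟩ := Ideal.Quotient.mk_surjective t
      rw [← map_mul, Ideal.Quotient.mk_eq_mk_iff_sub_mem, Ideal.mem_span_singleton] at ht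
      have := hJf.trans ht
      exact (dvd_sub_left (Dvd.intro _ rfl)).1 this
    · exact fun h => map_dvd _ h
  rw [ext_one_iff _ (Ideal.Quotient.mk (Ideal.span {∏ i, f i}) (∏ i ∈ Iᶜ, f i))
    (by rw [← map_mul, hzero, hfull])
    (by
      intro x hx
      obtain ⟨x, rfl⟩ := Ideal.Quotient.mk_surjective x
      rw [← map_mul, hzero, ← hfull, mul_comm, mul_dvd_mul_iff_left (hne _)] at hx
      exact map_dvd _ hx)
    (by
      intro x hx
      obtain ⟨x, rfl⟩ := Ideal.Quotient.mk_surjective x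
      rw [← map_mul, hzero, ← hfull, mul_dvd_mul_iff_left (hne _)] at hx
      exact map_dvd _ hx)]
  have hconv : (∀ x : ((S ⧸ Ideal.span {∏ i, f i}) ⧸
        Ideal.span {Ideal.Quotient.mk (Ideal.span {∏ i, f i}) (∏ i ∈ J, f i)}),
        (Ideal.Quotient.mk (Ideal.span {∏ i, f i}) (∏ i ∈ Iᶜ, f i)) • x = 0 →
        ∃ y, (Ideal.Quotient.mk (Ideal.span {∏ i, f i}) (∏ i ∈ I, f i)) • y = x) ↔
      ∀ s : S, ∏ i ∈ J, f i ∣ (∏ i ∈ Iᶜ, f i) * s →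
        ∃ t, ∏ i ∈ J, f i ∣ (∏ i ∈ I, f i) * t - s := by
    constructor
    · intro H s hs
      obtain ⟨y, hy⟩ := H (Ideal.Quotient.mk _ (Ideal.Quotient.mk _ s)) (by
        rw [← hzero2, map_mul, map_mul] at hs
        exact hs)
      obtain ⟨y, rfl⟩ := Ideal.Quotient.mk_surjective y
      obtain ⟨t, rfl⟩ := Ideal.Quotient.mk_surjective y
      refine ⟨t, ?_⟩
      rw [← hzero2, map_sub, map_sub, map_mul, map_mul, sub_eq_zero]
      exact hy
    · intro H x hx
      obtain ⟨x, rfl⟩ := Ideal.Quotient.mk_surjective x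
      obtain ⟨s, rfl⟩ := Ideal.Quotient.mk_surjective x
      obtain ⟨t, ht⟩ := H s (by
        rw [← hzero2, map_mul, map_mul]
        exact hx)
      refine ⟨Ideal.Quotient.mk _ (Ideal.Quotient.mk _ t), ?_⟩
      rw [← hzero2, map_sub, map_sub, map_mul, map_mul, sub_eq_zero] at ht
      exact ht
  rw [hconv]
  constructor
  · intro H
    by_contra! hcon
    obtain ⟨⟨i, hi, hiJ⟩, ⟨j, hj, hjI⟩⟩ := hcon.imp Finset.not_subset.1 Finset.not_subset.1
    have hsplitI : (∏ i ∈ I ∩ J, f i) * (∏ i ∈ I \ J, f i) = ∏ i ∈ I, f i :=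
      Finset.prod_inter_mul_prod_sdiff I J f
    have hsplitJ : (∏ i ∈ I ∩ J, f i) * (∏ i ∈ J \ I, f i) = ∏ i ∈ J, f i := by
      rw [Finset.inter_comm]
      exact Finset.prod_inter_mul_prod_sdiff J I f
    obtain ⟨t, z, htz⟩ := H (∏ i ∈ I ∩ J, f i) (by
      rw [← hsplitJ, mul_comm]
      refine mul_dvd_mul_right (Finset.prod_dvd_prod_of_subset _ _ _ ?_) _
      intro k hk
      simp at hk ⊢
      exact hk.2)
    rw [← hsplitI, ← hsplitJ] at htz
    have h1 : (∏ i ∈ I \ J, f i) * t - (∏ i ∈ J \ I, f i) * z = 1 := by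
      apply mul_left_cancel₀ (hne (I ∩ J))
      linear_combination htz
    have hmem : ∀ (A : Finset (Fin n)) k, k ∈ A → ∏ i ∈ A, f i ∈ maximalIdeal S := by
      intro A k hk
      exact Ideal.mem_of_dvd _ (Finset.dvd_prod_of_mem f hk)
        ((IsLocalRing.mem_maximalIdeal _).2 (hprime k).not_isUnit)
    have h2 : (1 : S) ∈ maximalIdeal S := by
      rw [← h1]
      exact Ideal.sub_mem _ (Ideal.mul_mem_right _ _ (hmem _ i (by simp [hi, hiJ])))
        (Ideal.mul_mem_right _ _ (hmem _ j (by simp [hj, hjI])))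
    exact (Ideal.ne_top_iff_one _).1 (Ideal.IsPrime.ne_top inferInstance) h2
  · rintro (h | h) s hs
    · obtain ⟨t, rfl⟩ := prod_dvd_of_disjoint f hprime hassoc Iᶜ I disjoint_compl_right s
        ((Finset.prod_dvd_prod_of_subset _ _ _ h).trans hs)
      exact ⟨t, by simp⟩
    · refine ⟨0, ?_⟩
      have := prod_dvd_of_disjoint f hprime hassoc Iᶜ J
        (disjoint_compl_right.mono_left h) s hs
      simpa using this
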